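/- Let m ≥ 2 and let H_m be the generalized quaternion group of order 2^{m+1} (Mathlib's QuaternionGroup 2^{m-1}). For the trivial H_m-representation on the field 𝔽₂ = ℤ/2, the group cohomology H^k(H_m; 𝔽₂) is a finite-dimensional 𝔽₂-vector space for every k ≥ 0, of dimension 2 if k ≡ 1 or 2 (mod 4) and of dimension 1 if k ≡ 0 or 3 (mod 4). -/

import Mathlib

namespace Representation

variable {k G : Type*} [CommSemiring k] [Monoid G]

lemma leftRegular_apply_eq_single_mul (g : G)
    (x : MonoidAlgebra k G) :
    Representation.leftRegular k G g x = MonoidAlgebra.single g 1 * x := by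
  induction x using MonoidAlgebra.induction_linear with
  | zero => simp
  | add x y hx hy => rw [map_add, hx, hy, mul_add]
  | single h r => simp

lemma finsupp_apply_apply {α V : Type*}
    [AddCommMonoid V] [Module k V] (ρ : Representation k G V) (g : G) (f : α →₀ V) (i : α) :
    ρ.finsupp α g f i = ρ g (f i) := by
  classical
  induction f using Finsupp.induction_linear with
  | zero => simp
  | add x y hx hy => simp [hx, hy]
  | single j v =>
    rw [Representation.finsupp_single, Finsupp.single_apply, Finsupp.single_apply]
    split_ifs <;> simp

end Representation

namespace Rep

open CategoryTheory

universe u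

variable {k G : Type u} [CommRing k] [Group G]

/-- An exact augmented sequence of projective representations, as a projective resolution. -/
noncomputable def projectiveResolutionOfExact {A : Rep.{u} k G} (P : ℕ → Rep.{u} k G)
    [∀ n, Projective (P n)] (d : ∀ n, P (n + 1) ⟶ P n) (ε : P 0 ⟶ A)
    (hd : ∀ n, d (n + 1) ≫ d n = 0) (hε : d 0 ≫ ε = 0)
    (hsurj : Function.Surjective ε.hom)
    (hex₀ : ∀ x, ε.hom x = 0 → ∃ y, (d 0).hom y = x)
    (hex : ∀ n x, (d n).hom x = 0 → ∃ y, (d (n + 1)).hom y = x) :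
    ProjectiveResolution A where
  complex := ChainComplex.of P d hd
  projective n := inferInstanceAs (Projective (P n))
  π := ((ChainComplex.of P d hd).toSingle₀Equiv A).symm
    ⟨ε, (congrArg (· ≫ ε) (ChainComplex.of_d P d 0)).trans hε⟩
  quasiIso := ⟨fun m => by
    induction m with
    | zero =>
      rw [ChainComplex.quasiIsoAt₀_iff, ShortComplex.quasiIso_iff_of_zeros' _ rfl rfl rfl]
      constructor
      · apply (forget₂ _ (ModuleCat k)).reflects_exact_of_faithful
        rw [ShortComplex.moduleCat_exact_iff]
        intro x hx
        obtain ⟨y, hy⟩ := hex₀ x (by simpa [ChainComplex.toSingle₀Equiv] using! hx)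
        exact ⟨y, (congrArg (fun f : P 1 ⟶ P 0 => f.hom y) (ChainComplex.of_d P d 0)).trans hy⟩
      · rw [Rep.epi_iff_surjective]
        simpa [ChainComplex.toSingle₀Equiv] using! hsurj
    | succ m _ =>
      rw [quasiIsoAt_iff_exactAt' (hL := ChainComplex.exactAt_succ_single_obj ..),
          HomologicalComplex.exactAt_iff' _ (m + 2) (m + 1) m (by simp) (by simp)]
      apply (forget₂ _ (ModuleCat k)).reflects_exact_of_faithful
      rw [ShortComplex.moduleCat_exact_iff]
      intro x hx
      obtain ⟨y, hy⟩ := hex m x ((congrArg (fun f : P (m + 1) ⟶ P m => f.hom x)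
        (ChainComplex.of_d P d m)).symm.trans hx)
      exact ⟨y, (congrArg (fun f : P (m + 2) ⟶ P (m + 1) => f.hom y)
        (ChainComplex.of_d P d (m + 1))).trans hy⟩⟩

/-- If every differential of a projective resolution of `k` becomes zero after applying
`Hom(-, A)`, then the cohomology of `A` is given by the modules of morphisms into `A`. -/
noncomputable def groupCohomologyLinearEquivHom (A : Rep.{u} k G)
    (P : ProjectiveResolution (Rep.trivial k G k))
    (h : ∀ (n : ℕ) (f : P.complex.X n ⟶ A), P.complex.d (n + 1) n ≫ f = 0) (n : ℕ) :
    groupCohomology A n ≃ₗ[k] (P.complex.X n ⟶ A) := by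
  have hd : ∀ i j, (P.complex.linearYonedaObj k A).d i j = 0 := fun i j => by
    by_cases hij : i + 1 = j
    · subst hij
      ext f
      exact h i f
    · exact (P.complex.linearYonedaObj k A).shape _ _ hij
  let S := (P.complex.linearYonedaObj k A).sc n
  exact (groupCohomologyIso A n P ≪≫ S.asIsoHomologyι (hd _ _) ≪≫
    (ShortComplex.opcyclesIsoX₂ S (hd _ _))).toLinearEquiv

section Matrix

open Matrix

variable {ι κ : Type} [Fintype ι] [Fintype κ]

/-- The morphism of free representations given by right multiplication with a matrix. -/
noncomputable def freeMatrixHom (M : Matrix ι κ (MonoidAlgebra k G)) : free k G ι ⟶ free k G κ :=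
  Rep.ofHom
    { toLinearMap := (Finsupp.linearEquivFunOnFinite k _ κ).symm.toLinearMap ∘ₗ
        M.vecMulLinear.restrictScalars k ∘ₗ (Finsupp.linearEquivFunOnFinite k _ ι).toLinearMap
      isIntertwining' g := by
        refine LinearMap.ext fun f => Finsupp.ext fun j => ?_
        change (⇑((leftRegular k G).ρ.finsupp ι g f) ᵥ* M) j =
          (leftRegular k G).ρ.finsupp κ g (Finsupp.equivFunOnFinite.symm (⇑f ᵥ* M)) j
        rw [Representation.finsupp_apply_apply]
        change _ = Representation.leftRegular k G g ((⇑f ᵥ* M) j)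
        rw [Representation.leftRegular_apply_eq_single_mul]
        simp only [vecMul, dotProduct, Finset.mul_sum, ← mul_assoc]
        refine Finset.sum_congr rfl fun i _ => ?_
        rw [Representation.finsupp_apply_apply]
        exact congrArg (· * M i j) (Representation.leftRegular_apply_eq_single_mul g (f i)) }

lemma freeMatrixHom_apply_eq_zero_iff {M : Matrix ι κ (MonoidAlgebra k G)}
    {f : ι →₀ MonoidAlgebra k G} : (freeMatrixHom M).hom f = 0 ↔ ⇑f ᵥ* M = 0 :=
  Finsupp.equivFunOnFinite.symm_apply_eq

lemma freeMatrixHom_zero : freeMatrixHom (0 : Matrix ι κ (MonoidAlgebra k G)) = 0 := by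
  refine Rep.hom_ext (Representation.IntertwiningMap.ext (LinearMap.ext fun f => ?_))
  exact freeMatrixHom_apply_eq_zero_iff.2 (vecMul_zero _)

lemma freeMatrixHom_comp {μ : Type} [Fintype μ] (M : Matrix ι κ (MonoidAlgebra k G))
    (N : Matrix κ μ (MonoidAlgebra k G)) :
    freeMatrixHom M ≫ freeMatrixHom N = freeMatrixHom (M * N) := by
  refine Rep.hom_ext (Representation.IntertwiningMap.ext (LinearMap.ext fun f => ?_))
  exact congrArg Finsupp.equivFunOnFinite.symm (vecMul_vecMul (⇑f) M N)

/-- The augmentation of a group algebra. -/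
noncomputable def augmentation : MonoidAlgebra k G →ₐ[k] k := MonoidAlgebra.lift k k G 1

omit [Fintype κ] in
lemma hom_single_eq_augmentation_smul (f : free k G κ ⟶ trivial k G k) (j : κ)
    (r : MonoidAlgebra k G) :
    f.hom (Finsupp.single j r) =
      augmentation r • f.hom (Finsupp.single j (MonoidAlgebra.single 1 1)) := by
  induction r using MonoidAlgebra.induction_linear with
  | zero => simp
  | add r s hr hs => simp [hr, hs, add_mul]
  | single g c =>
    have hc : Finsupp.single j (MonoidAlgebra.single g c) =
        c • (free k G κ).ρ g (Finsupp.single j (MonoidAlgebra.single 1 1)) := by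
      refine Eq.trans ?_ (congrArg (c • ·) (Representation.finsupp_single ..).symm)
      simp
    rw [hc, map_smul, hom_comm_apply]
    simp [augmentation]

lemma freeMatrixHom_comp_eq_zero {M : Matrix ι κ (MonoidAlgebra k G)}
    (hM : ∀ i j, augmentation (M i j) = 0) (f : free k G κ ⟶ trivial k G k) :
    freeMatrixHom M ≫ f = 0 := by
  classical
  refine free_ext _ _ _ _ _ fun i => ?_
  change f.hom (Finsupp.equivFunOnFinite.symm
    (⇑(Finsupp.single i (MonoidAlgebra.single 1 1)) ᵥ* M)) = 0
  rw [← Finsupp.univ_sum_single (Finsupp.equivFunOnFinite.symm _), map_sum]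
  refine Finset.sum_eq_zero fun j _ => ?_
  rw [hom_single_eq_augmentation_smul]
  have : (⇑(Finsupp.single i (MonoidAlgebra.single (1 : G) (1 : k))) ᵥ* M) j = M i j := by
    rw [Finsupp.single_eq_pi_single, single_vecMul, ← MonoidAlgebra.one_def]
    simp
  refine Eq.trans (congrArg (augmentation · • _) (this : _ = M i j)) ?_
  rw [hM, zero_smul]

end Matrix

end Rep

namespace QuaternionGroup

open MonoidAlgebra

variable (n : ℕ)

/-- The group algebra `𝔽₂[Q₄ₙ]`. -/
abbrev GroupAlgebra : Type := MonoidAlgebra (ZMod 2) (QuaternionGroup n)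

namespace GroupAlgebra

/-- The generator `a` of the cyclic subgroup, as an element of the group algebra. -/
noncomputable def X : GroupAlgebra n := single (a 1) 1

/-- The generator `xa 0`, as an element of the group algebra. -/
noncomputable def Y : GroupAlgebra n := single (xa 0) 1

/-- The partial norm `1 + a + ⋯ + aⁿ⁻¹`. -/
noncomputable def L : GroupAlgebra n := ∑ i ∈ Finset.range n, X n ^ i

/-- The norm element of the cyclic subgroup generated by `a`. -/
noncomputable def cyclicNorm : GroupAlgebra n := L n * (1 + X n ^ n)

/-- The norm element of the whole group. -/
noncomputable def fullNorm : GroupAlgebra n := (1 + Y n) * cyclicNorm n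

variable {n}

lemma add_self_eq_zero (r : GroupAlgebra n) : r + r = 0 := by
  ext g
  simpa using CharTwo.add_self_eq_zero (r.coeff g)

lemma add_eq_zero_iff {r s : GroupAlgebra n} : r + s = 0 ↔ r = s := by
  rw [← add_left_inj s, add_assoc, add_self_eq_zero, add_zero, zero_add]

lemma add_eq_iff_eq_add {r s t : GroupAlgebra n} : r + s = t ↔ r = t + s := by
  rw [← add_left_inj s, add_assoc, add_self_eq_zero, add_zero]

lemma X_pow (i : ℕ) : X n ^ i = single (a (i : ZMod (2 * n))) 1 := by
  induction i with
  | zero => rw [pow_zero, Nat.cast_zero, a_zero, MonoidAlgebra.one_def]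
  | succ i ih => rw [pow_succ, ih, X, single_mul_single]; simp

lemma X_mul_Y_mul_X : X n * Y n * X n = Y n := by
  simp [X, Y]

lemma Y_mul_Y : Y n * Y n = X n ^ n := by
  simp [X_pow, Y]

lemma X_pow_two_mul : X n ^ (2 * n) = 1 := by
  rw [X_pow, ZMod.natCast_self]; rfl

lemma X_mul_L : X n * L n = L n * X n := by
  simp [L, Finset.mul_sum, Finset.sum_mul, ← pow_succ, ← pow_succ']

lemma L_mul_X_add_one : L n * (X n + 1) = X n ^ n + 1 := by
  have := geom_sum_mul (X n) n
  have h2 (r : GroupAlgebra n) : r - 1 = r + 1 := by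
    rw [sub_eq_iff_eq_add, add_assoc, add_self_eq_zero, add_zero]
  rwa [h2, h2] at this

lemma X_add_one_mul_L : (X n + 1) * L n = X n ^ n + 1 := by
  rw [← L_mul_X_add_one, add_mul, mul_add, X_mul_L, one_mul, mul_one]

lemma X_pow_mul_Y (i : ℕ) (hi : i ≤ 2 * n) : X n ^ i * Y n = Y n * X n ^ (2 * n - i) := by
  simp [X_pow, Y, Nat.cast_sub hi, -Nat.cast_mul]

lemma L_mul_X_mul_Y : L n * (X n * Y n) = Y n * (X n ^ n * L n) := by
  rw [L, Finset.sum_mul, Finset.mul_sum, Finset.mul_sum, ← Finset.sum_range_reflect]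
  refine Finset.sum_congr rfl fun i hi => ?_
  rw [Finset.mem_range] at hi
  rw [← mul_assoc, ← pow_succ, X_pow_mul_Y _ (by omega), ← pow_add]
  congr 2
  omega

lemma cyclicNorm_mul_X : cyclicNorm n * X n = cyclicNorm n := by
  rw [← add_eq_zero_iff]
  calc cyclicNorm n * X n + cyclicNorm n = L n * ((1 + X n ^ n) * (X n + 1)) := by
        rw [cyclicNorm]; noncomm_ring
    _ = L n * ((X n + 1) * (1 + X n ^ n)) := by
        congr 1
        exact ((Commute.one_left _).add_left (.pow_left (.add_right (.refl _) (.one_right _)) _)).eq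
    _ = (X n ^ n + 1) * (1 + X n ^ n) := by rw [← mul_assoc, L_mul_X_add_one]
    _ = (1 + X n ^ (2 * n)) + (X n ^ n + X n ^ n) := by rw [two_mul, pow_add]; noncomm_ring
    _ = 0 := by rw [X_pow_two_mul, add_self_eq_zero, add_self_eq_zero, add_zero]

lemma X_mul_cyclicNorm : X n * cyclicNorm n = cyclicNorm n := by
  conv_rhs => rw [← cyclicNorm_mul_X]
  rw [cyclicNorm, ← mul_assoc, X_mul_L, mul_assoc, mul_assoc, mul_add, add_mul, ← pow_succ,
    ← pow_succ', mul_one, one_mul]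

lemma cyclicNorm_eq_sum : cyclicNorm n = ∑ i ∈ Finset.range (2 * n), X n ^ i := by
  rw [two_mul, Finset.sum_range_add, cyclicNorm, mul_add, mul_one, L, Finset.sum_mul]
  simp [← pow_add, add_comm]

lemma cyclicNorm_mul_Y : cyclicNorm n * Y n = Y n * cyclicNorm n := by
  have hX : Commute (L n) (X n ^ n) := .pow_right X_mul_L.symm n
  have hXY : Commute (X n ^ n) (X n * Y n) := by
    refine .mul_right (.pow_left (.refl _) _) ?_
    rw [← Y_mul_Y]
    exact .mul_left (.refl _) (.refl _)
  have h1 : Commute (1 + X n ^ n) (X n * Y n) := .add_left (.one_left _) hXY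
  calc cyclicNorm n * Y n = L n * ((1 + X n ^ n) * (X n * Y n)) := by
        conv_lhs => rw [← cyclicNorm_mul_X, cyclicNorm]
        simp only [mul_assoc]
    _ = L n * (X n * Y n) * (1 + X n ^ n) := by rw [h1.eq]; simp only [mul_assoc]
    _ = Y n * (X n ^ n * cyclicNorm n) := by
        rw [L_mul_X_mul_Y, cyclicNorm]; simp only [mul_assoc]
    _ = Y n * cyclicNorm n := by
        congr 1
        rw [cyclicNorm, ← mul_assoc, ← hX.eq, mul_assoc, mul_add, ← pow_add, ← two_mul,
          X_pow_two_mul, mul_one, add_comm]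

lemma Y_mul_Y_mul_cyclicNorm : Y n * (Y n * cyclicNorm n) = cyclicNorm n := by
  have h (i : ℕ) : X n ^ i * cyclicNorm n = cyclicNorm n := by
    induction i with
    | zero => simp
    | succ i ih => rw [pow_succ, mul_assoc, X_mul_cyclicNorm, ih]
  rw [← mul_assoc, Y_mul_Y, h]

lemma X_mul_Y_mul_cyclicNorm : X n * (Y n * cyclicNorm n) = Y n * cyclicNorm n := by
  conv_lhs => rw [← X_mul_cyclicNorm]
  rw [← mul_assoc (Y n), ← mul_assoc, ← mul_assoc, X_mul_Y_mul_X]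

/-- The element `α + β Y` of the group algebra, for `c = (α, β)`. -/
noncomputable def repr : (ZMod 2 × ZMod 2) →ₗ[ZMod 2] GroupAlgebra n :=
  (LinearMap.toSpanSingleton _ _ 1).coprod (LinearMap.toSpanSingleton _ _ (Y n))

lemma repr_apply (α β : ZMod 2) : repr (α, β) = α • (1 : GroupAlgebra n) + β • Y n := by
  simp [repr]

/-- The indicator of the coset of the cyclic subgroup generated by `a`. -/
def cosetIndicator : QuaternionGroup n → ZMod 2 × ZMod 2
  | a _ => (1, 0)
  | xa _ => (0, 1)

/-- The sums of coefficients over the two cosets of the cyclic subgroup generated by `a`. -/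
noncomputable def cosetSum : GroupAlgebra n →ₗ[ZMod 2] ZMod 2 × ZMod 2 :=
  Finsupp.linearCombination _ cosetIndicator ∘ₗ (coeffLinearEquiv _).toLinearMap

lemma cosetSum_single (g : QuaternionGroup n) (c : ZMod 2) :
    cosetSum (single g c) = c • cosetIndicator g := by
  simp [cosetSum]

lemma cosetSum_mul_X (r : GroupAlgebra n) : cosetSum (r * X n) = cosetSum r := by
  induction r using MonoidAlgebra.induction_linear with
  | zero => simp
  | add r s hr hs => simp [add_mul, hr, hs]
  | single g c =>
    rw [X, single_mul_single, cosetSum_single, cosetSum_single]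
    cases g <;> simp [cosetIndicator]

lemma cosetSum_mul_Y (r : GroupAlgebra n) : cosetSum (r * Y n) = (cosetSum r).swap := by
  induction r using MonoidAlgebra.induction_linear with
  | zero => simp
  | add r s hr hs => simp [add_mul, hr, hs]
  | single g c =>
    rw [Y, single_mul_single, cosetSum_single, cosetSum_single]
    cases g <;> simp [cosetIndicator]

section

variable [NeZero n]

lemma exists_eq_repr_cosetSum_add (r : GroupAlgebra n) :
    ∃ w, r = repr (cosetSum r) + w * (X n + 1) := by
  have key (i : ZMod (2 * n)) : ∃ w : GroupAlgebra n, single (a i) 1 = 1 + w * (X n + 1) := by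
    obtain ⟨i, rfl⟩ := ZMod.natCast_zmod_surjective i
    rw [← X_pow]
    induction i with
    | zero => exact ⟨0, by simp⟩
    | succ i ih =>
      obtain ⟨w, hw⟩ := ih
      refine ⟨w * X n + 1, ?_⟩
      rw [pow_succ, hw]
      have := add_self_eq_zero (1 : GroupAlgebra n)
      calc _ = 1 + (w * X n + 1) * (X n + 1) - (1 + 1) := by noncomm_ring
        _ = _ := by rw [this, sub_zero]
  induction r using MonoidAlgebra.induction_linear with
  | zero => exact ⟨0, by simp⟩
  | add r s hr hs =>
    obtain ⟨v, hv⟩ := hr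
    obtain ⟨w, hw⟩ := hs
    refine ⟨v + w, ?_⟩
    rw [map_add, map_add, add_mul]
    nth_rw 1 [hv, hw]
    abel
  | single g c =>
    have hc : single g c = c • single g 1 := by simp
    rw [cosetSum_single]
    cases g with
    | a i =>
      obtain ⟨w, hw⟩ := key i
      exact ⟨c • w, by rw [hc, hw]; simp [cosetIndicator, repr_apply]⟩
    | xa i =>
      obtain ⟨w, hw⟩ := key i
      have h : single (xa i) 1 = Y n * single (a i) 1 := by simp [Y]
      exact ⟨c • (Y n * w), by
        rw [hc, h, hw]; simp [cosetIndicator, repr_apply, mul_add, mul_assoc]⟩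

lemma cyclicNorm_eq_sum_zmod : cyclicNorm n = ∑ i : ZMod (2 * n), single (a i) 1 := by
  rw [cyclicNorm_eq_sum]
  refine Finset.sum_nbij' (fun i => (i : ZMod (2 * n))) ZMod.val ?_ ?_ ?_ ?_ ?_
  · simp
  · simp [ZMod.val_lt]
  · intro i hi
    exact ZMod.val_cast_of_lt (Finset.mem_range.1 hi)
  · simp
  · intro i _
    exact X_pow i

lemma coeff_repr_mul_cyclicNorm (α β : ZMod 2) (i : ZMod (2 * n)) :
    (repr (α, β) * cyclicNorm n).coeff (a i) = α ∧
      (repr (α, β) * cyclicNorm n).coeff (xa i) = β := by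
  classical
  constructor <;> simp [repr_apply, add_mul, Y, cyclicNorm_eq_sum_zmod, Finset.mul_sum, coeff_sum,
    Finsupp.single_apply, Finset.sum_apply']

lemma repr_mul_cyclicNorm_eq_zero {c : ZMod 2 × ZMod 2} (h : repr c * cyclicNorm n = 0) :
    c = 0 := by
  obtain ⟨α, β⟩ := c
  have h1 := coeff_repr_mul_cyclicNorm (n := n) α β 0
  rw [h] at h1
  ext <;> simp [← h1.1, ← h1.2]

lemma exists_eq_repr_mul_cyclicNorm {r : GroupAlgebra n} (h : r * (X n + 1) = 0) :
    ∃ c, r = repr c * cyclicNorm n := by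
  rw [mul_add, mul_one, add_eq_zero_iff] at h
  have key (g : QuaternionGroup n) : r.coeff (g * a 1) = r.coeff g := by
    conv_lhs => rw [← h]
    simp [X]
  refine ⟨(r.coeff (a 0), r.coeff (xa 0)), ?_⟩
  ext g
  cases g with
  | a i =>
    rw [(coeff_repr_mul_cyclicNorm _ _ i).1]
    obtain ⟨i, rfl⟩ := ZMod.natCast_zmod_surjective i
    induction i with
    | zero => simp
    | succ i ih => rw [← ih, ← key (a i)]; simp
  | xa i =>
    rw [(coeff_repr_mul_cyclicNorm _ _ i).2]
    obtain ⟨i, rfl⟩ := ZMod.natCast_zmod_surjective i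
    induction i with
    | zero => simp
    | succ i ih => rw [← ih, ← key (xa i)]; simp

lemma exists_eq_of_cosetSum_add_eq_zero {r : GroupAlgebra n}
    (h : (cosetSum r).1 + (cosetSum r).2 = 0) :
    ∃ p q, r = p * (X n + 1) + q * (Y n + 1) := by
  obtain ⟨w, hw⟩ := exists_eq_repr_cosetSum_add r
  generalize cosetSum r = c at h hw
  obtain ⟨α, β⟩ := c
  obtain rfl : α = β := CharTwo.add_eq_zero.1 h
  refine ⟨w, α • 1, ?_⟩
  rw [hw, repr_apply, smul_mul_assoc, one_mul, smul_add]
  abel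

lemma exists_eq_smul_add_of_mul_eq {r s : GroupAlgebra n} (h : r * (X n + 1) = s * (Y n + 1)) :
    ∃ (α : ZMod 2) (w : GroupAlgebra n), s = α • (1 + Y n) + w * (X n + 1) := by
  obtain ⟨w, hw⟩ := exists_eq_repr_cosetSum_add s
  have h' := congrArg cosetSum h
  rw [mul_add, mul_add, map_add, map_add, cosetSum_mul_X, cosetSum_mul_Y, mul_one, mul_one,
    CharTwo.add_self_eq_zero] at h'
  generalize cosetSum s = c at h' hw
  obtain ⟨α, β⟩ := c
  obtain rfl : β = α := CharTwo.add_eq_zero.1 (congrArg Prod.fst h').symm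
  exact ⟨β, w, by rw [hw, repr_apply, smul_add]⟩

end

lemma X_mul_Y_add_one_mul_X_add_one :
    (X n * Y n + 1) * (X n + 1) = (X n + 1) * (Y n + 1) := by
  calc _ = X n * Y n * X n + X n * Y n + X n + 1 := by noncomm_ring
    _ = _ := by rw [X_mul_Y_mul_X]; noncomm_ring

lemma X_mul_Y_add_one_mul_self : (X n * Y n + 1) * (X n * Y n + 1) = X n ^ n + 1 := by
  calc _ = X n * Y n * X n * Y n + 1 + (X n * Y n + X n * Y n) := by noncomm_ring
    _ = _ := by rw [X_mul_Y_mul_X, Y_mul_Y, add_self_eq_zero, add_zero]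

lemma Y_add_one_mul_self : (Y n + 1) * (Y n + 1) = X n ^ n + 1 := by
  calc _ = Y n * Y n + 1 + (Y n + Y n) := by noncomm_ring
    _ = _ := by rw [Y_mul_Y, add_self_eq_zero, add_zero]

lemma Y_add_one_mul_L_add :
    (Y n + 1) * L n + L n * (X n * Y n + 1) = Y n * cyclicNorm n := by
  have hX : L n * X n ^ n = X n ^ n * L n := (Commute.pow_right X_mul_L.symm n).eq
  calc _ = Y n * L n + L n * (X n * Y n) + (L n + L n) := by noncomm_ring
    _ = _ := by rw [add_self_eq_zero, add_zero, L_mul_X_mul_Y, cyclicNorm, ← hX]; noncomm_ring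

lemma cyclicNorm_mul_X_add_one : cyclicNorm n * (X n + 1) = 0 := by
  rw [mul_add, cyclicNorm_mul_X, mul_one, add_self_eq_zero]

lemma cyclicNorm_mul_X_mul_Y_add_one :
    cyclicNorm n * (X n * Y n + 1) = (1 + Y n) * cyclicNorm n := by
  rw [mul_add, ← mul_assoc, cyclicNorm_mul_X, cyclicNorm_mul_Y, mul_one, add_mul, one_mul, add_comm]

lemma repr_mul_fullNorm (c : ZMod 2 × ZMod 2) :
    repr c * fullNorm n = (c.1 + c.2) • fullNorm n := by
  have hY : Y n * fullNorm n = fullNorm n := by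
    rw [fullNorm, add_mul, one_mul, mul_add, Y_mul_Y_mul_cyclicNorm, add_comm]
  obtain ⟨α, β⟩ := c
  rw [repr_apply, add_mul, smul_mul_assoc, smul_mul_assoc, hY, one_mul, add_smul]

lemma X_mul_fullNorm : X n * fullNorm n = fullNorm n := by
  rw [fullNorm, add_mul, one_mul, mul_add, X_mul_Y_mul_cyclicNorm, X_mul_cyclicNorm]

lemma fullNorm_mul_X_add_one : fullNorm n * (X n + 1) = 0 := by
  rw [fullNorm, mul_assoc, cyclicNorm_mul_X_add_one, mul_zero]

lemma fullNorm_mul_X_mul_Y_add_one : fullNorm n * (X n * Y n + 1) = 0 := by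
  rw [fullNorm, mul_assoc, cyclicNorm_mul_X_mul_Y_add_one, ← fullNorm, add_mul, one_mul]
  have := repr_mul_fullNorm (n := n) (1, 1)
  rwa [repr_apply, one_smul, one_smul, add_mul, one_mul, CharTwo.add_self_eq_zero, zero_smul]
    at this

lemma X_add_one_mul_fullNorm : (X n + 1) * fullNorm n = 0 := by
  rw [add_mul, X_mul_fullNorm, one_mul, add_self_eq_zero]

lemma Y_add_one_mul_fullNorm : (Y n + 1) * fullNorm n = 0 := by
  have := repr_mul_fullNorm (n := n) (1, 1)
  rwa [repr_apply, one_smul, one_smul, CharTwo.add_self_eq_zero, zero_smul, add_comm] at this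

section

variable [NeZero n]

lemma smul_fullNorm_eq_zero {α : ZMod 2} (h : α • fullNorm n = 0) : α = 0 := by
  have : repr (α, α) * cyclicNorm n = 0 := by
    rwa [repr_apply, ← smul_add, smul_mul_assoc, ← fullNorm]
  exact congrArg Prod.fst (repr_mul_cyclicNorm_eq_zero this)

lemma cosetSum_add_eq_zero_of_mul_fullNorm {r : GroupAlgebra n} (h : r * fullNorm n = 0) :
    (cosetSum r).1 + (cosetSum r).2 = 0 := by
  obtain ⟨w, hw⟩ := exists_eq_repr_cosetSum_add r
  rw [hw, add_mul, mul_assoc, X_add_one_mul_fullNorm, mul_zero, add_zero, repr_mul_fullNorm] at h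
  exact smul_fullNorm_eq_zero h

omit [NeZero n] in
lemma repr_mul_cyclicNorm_mul (c : ZMod 2 × ZMod 2) :
    repr c * cyclicNorm n * (X n * Y n + 1) = (c.1 + c.2) • fullNorm n := by
  rw [mul_assoc, cyclicNorm_mul_X_mul_Y_add_one, ← fullNorm, repr_mul_fullNorm]

lemma exists_eq_mul_fullNorm {w : GroupAlgebra n} (hX : w * (X n + 1) = 0)
    (hXY : w * (X n * Y n + 1) = 0) : ∃ v, w = v * fullNorm n := by
  obtain ⟨⟨α, β⟩, rfl⟩ := exists_eq_repr_mul_cyclicNorm hX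
  rw [repr_mul_cyclicNorm_mul] at hXY
  obtain rfl : α = β := CharTwo.add_eq_zero.1 (smul_fullNorm_eq_zero hXY)
  refine ⟨α • 1, ?_⟩
  rw [repr_apply, fullNorm, ← mul_assoc, ← smul_add, smul_mul_assoc α 1, one_mul]

lemma exists_eq_of_mul_add_mul_eq_zero {r s : GroupAlgebra n}
    (h : r * (X n + 1) + s * (Y n + 1) = 0) :
    ∃ u v, r = u * L n + v * (X n * Y n + 1) ∧ s = u * (Y n + 1) + v * (X n + 1) := by
  rw [add_eq_zero_iff] at h
  obtain ⟨α, w, rfl⟩ := exists_eq_smul_add_of_mul_eq h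
  have h0 : (r + α • L n + w * (X n * Y n + 1)) * (X n + 1) = 0 := by
    rw [add_mul, add_mul, h, mul_assoc w, X_mul_Y_add_one_mul_X_add_one, smul_mul_assoc,
      L_mul_X_add_one, ← Y_add_one_mul_self, add_mul, smul_mul_assoc, add_comm 1, mul_assoc w,
      add_assoc, add_comm (_ • _) (w * _), add_add_add_comm, add_comm, add_add_add_comm,
      add_self_eq_zero]
  obtain ⟨c, hc⟩ := exists_eq_repr_mul_cyclicNorm h0
  rw [add_assoc, add_eq_iff_eq_add] at hc
  have hα (t z : GroupAlgebra n) : (α • 1 + t) * z = α • z + t * z := by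
    rw [add_mul, smul_mul_assoc, one_mul]
  refine ⟨α • 1 + repr c * Y n * (Y n + 1), w + repr c * Y n * L n, ?_, ?_⟩
  · rw [hc, hα]
    calc _ = repr c * (Y n * ((Y n + 1) * L n + L n * (X n * Y n + 1))) +
          (α • L n + w * (X n * Y n + 1)) := by
          rw [Y_add_one_mul_L_add, Y_mul_Y_mul_cyclicNorm]
      _ = _ := by
          generalize α • L n = z
          generalize repr c = c
          noncomm_ring
  · have h1 : repr c * Y n * ((Y n + 1) * (Y n + 1) + L n * (X n + 1)) = 0 := by
      rw [Y_add_one_mul_self, L_mul_X_add_one, add_self_eq_zero, mul_zero]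
    rw [hα, add_comm 1, ← add_zero (_ + _), ← h1]
    generalize α • (Y n + 1) = z
    generalize repr c = c
    noncomm_ring

lemma exists_eq_of_mul_L_add_eq_zero {u v : GroupAlgebra n}
    (h₁ : u * L n + v * (X n * Y n + 1) = 0) (h₂ : u * (Y n + 1) + v * (X n + 1) = 0) :
    ∃ w, u = w * (X n + 1) ∧ v = w * (X n * Y n + 1) := by
  obtain ⟨α, w, rfl⟩ := exists_eq_smul_add_of_mul_eq (add_eq_zero_iff.1 ((add_comm _ _).trans h₂))
  obtain ⟨v, rfl⟩ : ∃ v', v = v' + w * (X n * Y n + 1) :=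
    ⟨v + w * (X n * Y n + 1), add_eq_iff_eq_add.1 rfl⟩
  have h₁' : α • ((1 + Y n) * L n) + v * (X n * Y n + 1) = 0 := by
    have : w * ((X n + 1) * L n + (X n * Y n + 1) * (X n * Y n + 1)) = 0 := by
      rw [X_add_one_mul_L, X_mul_Y_add_one_mul_self, add_self_eq_zero, mul_zero]
    rw [← h₁, ← add_zero (_ + _), ← this, ← smul_mul_assoc]
    noncomm_ring
  have h₂' : (v + α • L n) * (X n + 1) = 0 := by
    have : w * ((X n + 1) * (Y n + 1) + (X n * Y n + 1) * (X n + 1)) = 0 := by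
      rw [X_mul_Y_add_one_mul_X_add_one, add_self_eq_zero, mul_zero]
    rw [add_mul, smul_mul_assoc, L_mul_X_add_one, ← Y_add_one_mul_self, ← h₂, ← add_zero (_ + _),
      ← this, ← smul_mul_assoc, add_comm (Y n) 1]
    noncomm_ring
  obtain ⟨⟨γ, δ⟩, hc⟩ := exists_eq_repr_mul_cyclicNorm h₂'
  rw [add_eq_iff_eq_add] at hc
  subst hc
  have h : repr (γ + δ, α + (γ + δ)) * cyclicNorm n = 0 := by
    calc _ = (γ + δ) • fullNorm n + α • (Y n * cyclicNorm n) := by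
          rw [repr_apply, fullNorm, ← smul_mul_assoc, ← smul_mul_assoc, ← add_mul, smul_add,
            add_smul α, add_assoc, add_comm (α • Y n)]
      _ = (γ + δ) • fullNorm n + α • ((1 + Y n) * L n + L n * (X n * Y n + 1)) := by
          rw [add_comm 1 (Y n), Y_add_one_mul_L_add]
      _ = _ := by
          rw [← h₁', add_mul (repr _ * _), repr_mul_cyclicNorm_mul, smul_mul_assoc, smul_add,
            add_left_comm]
  have h0 := repr_mul_cyclicNorm_eq_zero h
  obtain rfl : γ = δ := CharTwo.add_eq_zero.1 (congrArg Prod.fst h0)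
  obtain rfl : α = 0 := by simpa [CharTwo.add_self_eq_zero] using congrArg Prod.snd h0
  refine ⟨w + γ • cyclicNorm n, ?_, ?_⟩
  · rw [add_mul, smul_mul_assoc, cyclicNorm_mul_X_add_one]
    simp
  · rw [add_mul, smul_mul_assoc, cyclicNorm_mul_X_mul_Y_add_one, repr_apply, ← smul_add,
      smul_mul_assoc]
    simp [add_comm]

end

end GroupAlgebra
end QuaternionGroup

namespace QuaternionGroup

open MonoidAlgebra CategoryTheory Matrix

namespace GroupAlgebra

/-- The ranks `1, 2, 2, 1, 1, 2, 2, 1, …` of the terms of the periodic free resolution. -/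
def resolutionRank : ℕ → ℕ
  | 0 => 1
  | 1 => 2
  | 2 => 2
  | 3 => 1
  | k + 4 => resolutionRank k

variable (n : ℕ)

/-- The matrices of the differentials of the periodic free resolution. -/
noncomputable def resolutionMatrix :
    ∀ k, Matrix (Fin (resolutionRank (k + 1))) (Fin (resolutionRank k)) (GroupAlgebra n)
  | 0 => (!![X n + 1; Y n + 1] : Matrix (Fin 2) (Fin 1) (GroupAlgebra n))
  | 1 => (!![L n, Y n + 1; X n * Y n + 1, X n + 1] : Matrix (Fin 2) (Fin 2) (GroupAlgebra n))
  | 2 => (!![X n + 1, X n * Y n + 1] : Matrix (Fin 1) (Fin 2) (GroupAlgebra n))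
  | 3 => (!![fullNorm n] : Matrix (Fin 1) (Fin 1) (GroupAlgebra n))
  | k + 4 => resolutionMatrix k

lemma resolutionRank_eq_two {k : ℕ} (hk : k % 4 = 1 ∨ k % 4 = 2) : resolutionRank k = 2 := by
  induction k using resolutionRank.induct with
  | case5 k ih => exact ih (by omega)
  | _ => simp_all [resolutionRank]

lemma resolutionRank_eq_one {k : ℕ} (hk : k % 4 = 0 ∨ k % 4 = 3) : resolutionRank k = 1 := by
  induction k using resolutionRank.induct with
  | case5 k ih => exact ih (by omega)
  | _ => simp_all [resolutionRank]

lemma resolutionMatrix_mul (k : ℕ) : resolutionMatrix n (k + 1) * resolutionMatrix n k = 0 := by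
  induction k using resolutionRank.induct with
  | case1 =>
    change (!![L n, Y n + 1; X n * Y n + 1, X n + 1] : Matrix (Fin 2) (Fin 2) _) *
      (!![X n + 1; Y n + 1] : Matrix (Fin 2) (Fin 1) _) = 0
    ext i j : 2
    fin_cases i <;> fin_cases j <;>
      simp [Matrix.mul_apply, L_mul_X_add_one, Y_add_one_mul_self, X_mul_Y_add_one_mul_X_add_one,
        add_self_eq_zero]
  | case2 =>
    change (!![X n + 1, X n * Y n + 1] : Matrix (Fin 1) (Fin 2) _) *
      (!![L n, Y n + 1; X n * Y n + 1, X n + 1] : Matrix (Fin 2) (Fin 2) _) = 0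
    ext i j : 2
    fin_cases i
    fin_cases j <;>
      simp [Matrix.mul_apply, X_add_one_mul_L, X_mul_Y_add_one_mul_self,
        X_mul_Y_add_one_mul_X_add_one, add_self_eq_zero]
  | case3 =>
    change (!![fullNorm n] : Matrix (Fin 1) (Fin 1) _) *
      (!![X n + 1, X n * Y n + 1] : Matrix (Fin 1) (Fin 2) _) = 0
    ext i j : 2
    fin_cases i
    fin_cases j <;> simp [Matrix.mul_apply, fullNorm_mul_X_add_one, fullNorm_mul_X_mul_Y_add_one]
  | case4 =>
    change (!![X n + 1; Y n + 1] : Matrix (Fin 2) (Fin 1) _) *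
      (!![fullNorm n] : Matrix (Fin 1) (Fin 1) _) = 0
    ext i j : 2
    fin_cases j
    fin_cases i <;> simp [Matrix.mul_apply, X_add_one_mul_fullNorm, Y_add_one_mul_fullNorm]
  | case5 k ih => exact ih

lemma exists_vecMul_resolutionMatrix_eq [NeZero n] (k : ℕ)
    (f : Fin (resolutionRank (k + 1)) → GroupAlgebra n) (hf : f ᵥ* resolutionMatrix n k = 0) :
    ∃ g, g ᵥ* resolutionMatrix n (k + 1) = f := by
  induction k using resolutionRank.induct with
  | case1 =>
    change Fin 2 → GroupAlgebra n at f
    change f ᵥ* (!![X n + 1; Y n + 1] : Matrix (Fin 2) (Fin 1) _) = 0 at hf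
    have h := congrFun hf 0
    simp [Matrix.vecMul, dotProduct] at h
    obtain ⟨u, v, h₀, h₁⟩ := exists_eq_of_mul_add_mul_eq_zero h
    refine ⟨(![u, v] : Fin 2 → _), ?_⟩
    change ![u, v] ᵥ* (!![L n, Y n + 1; X n * Y n + 1, X n + 1] : Matrix (Fin 2) (Fin 2) _) = f
    ext i : 1
    fin_cases i <;> simp [Matrix.vecMul, dotProduct, h₀, h₁]
  | case2 =>
    change Fin 2 → GroupAlgebra n at f
    change f ᵥ* (!![L n, Y n + 1; X n * Y n + 1, X n + 1] : Matrix (Fin 2) (Fin 2) _) = 0 at hf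
    have h₀ := congrFun hf 0
    have h₁ := congrFun hf 1
    simp [Matrix.vecMul, dotProduct] at h₀ h₁
    obtain ⟨w, hw₀, hw₁⟩ := exists_eq_of_mul_L_add_eq_zero h₀ h₁
    refine ⟨(![w] : Fin 1 → _), ?_⟩
    change ![w] ᵥ* (!![X n + 1, X n * Y n + 1] : Matrix (Fin 1) (Fin 2) _) = f
    ext i : 1
    fin_cases i <;> simp [Matrix.vecMul, dotProduct, hw₀, hw₁]
  | case3 =>
    change Fin 1 → GroupAlgebra n at f
    change f ᵥ* (!![X n + 1, X n * Y n + 1] : Matrix (Fin 1) (Fin 2) _) = 0 at hf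
    have h₀ := congrFun hf 0
    have h₁ := congrFun hf 1
    simp [Matrix.vecMul, dotProduct] at h₀ h₁
    obtain ⟨v, hv⟩ := exists_eq_mul_fullNorm h₀ h₁
    refine ⟨(![v] : Fin 1 → _), ?_⟩
    change ![v] ᵥ* (!![fullNorm n] : Matrix (Fin 1) (Fin 1) _) = f
    ext i : 1
    fin_cases i
    simp [Matrix.vecMul, dotProduct, hv]
  | case4 =>
    change Fin 1 → GroupAlgebra n at f
    change f ᵥ* (!![fullNorm n] : Matrix (Fin 1) (Fin 1) _) = 0 at hf
    have h := congrFun hf 0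
    simp [Matrix.vecMul, dotProduct] at h
    obtain ⟨p, q, hpq⟩ := exists_eq_of_cosetSum_add_eq_zero (cosetSum_add_eq_zero_of_mul_fullNorm h)
    refine ⟨(![p, q] : Fin 2 → _), ?_⟩
    change ![p, q] ᵥ* (!![X n + 1; Y n + 1] : Matrix (Fin 2) (Fin 1) _) = f
    ext i : 1
    fin_cases i
    simp [Matrix.vecMul, dotProduct, hpq]
  | case5 k ih => exact ih f hf

variable {n}

lemma augmentation_X : Rep.augmentation (X n) = 1 := by simp [Rep.augmentation, X]

lemma augmentation_Y : Rep.augmentation (Y n) = 1 := by simp [Rep.augmentation, Y]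

lemma augmentation_L (hn : Even n) : Rep.augmentation (L n) = 0 := by
  simp [L, augmentation_X, hn.natCast_zmod_two]

lemma augmentation_fullNorm : Rep.augmentation (fullNorm n) = 0 := by
  simp [fullNorm, augmentation_Y, CharTwo.add_self_eq_zero]

lemma augmentation_resolutionMatrix (hn : Even n) (k : ℕ) (i : Fin (resolutionRank (k + 1)))
    (j : Fin (resolutionRank k)) : Rep.augmentation (resolutionMatrix n k i j) = 0 := by
  induction k using resolutionRank.induct with
  | case5 k ih => exact ih i j
  | _ =>
    simp only [resolutionRank] at i j
    fin_cases i <;> fin_cases j <;>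
      simp [resolutionMatrix, augmentation_X, augmentation_Y, augmentation_L hn,
        augmentation_fullNorm, CharTwo.add_self_eq_zero]

lemma augmentation_eq_cosetSum (r : GroupAlgebra n) :
    Rep.augmentation r = (cosetSum r).1 + (cosetSum r).2 := by
  induction r using MonoidAlgebra.induction_linear with
  | zero => simp
  | add r s hr hs => rw [map_add, map_add, hr, hs, Prod.fst_add, Prod.snd_add]; abel
  | single g c =>
    rw [cosetSum_single]
    cases g <;> simp [Rep.augmentation, cosetIndicator]

variable (n) in
/-- The augmentation of the periodic free resolution. -/
noncomputable def resolutionAugmentation :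
    Rep.free (ZMod 2) (QuaternionGroup n) (Fin 1) ⟶
      Rep.trivial (ZMod 2) (QuaternionGroup n) (ZMod 2) :=
  Rep.freeLift _ _ _ fun _ => (1 : ZMod 2)

lemma resolutionAugmentation_single (j : Fin 1) (r : GroupAlgebra n) :
    (resolutionAugmentation n).hom (Finsupp.single j r) = Rep.augmentation r := by
  rw [Rep.hom_single_eq_augmentation_smul]
  have h : (resolutionAugmentation n).hom (Finsupp.single j (single 1 1)) =
      (1 : ZMod 2) • (1 : ZMod 2) :=
    Representation.freeLift_single_single
      (Rep.trivial (ZMod 2) (QuaternionGroup n) (ZMod 2)).ρ j 1 1 fun _ => (1 : ZMod 2)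
  rw [h, one_smul]
  exact mul_one _

lemma exists_freeMatrixHom_eq_of_resolutionAugmentation_eq_zero [NeZero n]
    (x : Fin 1 →₀ GroupAlgebra n) (hx : (resolutionAugmentation n).hom x = 0) :
    ∃ y, (Rep.freeMatrixHom (resolutionMatrix n 0)).hom y = x := by
  obtain ⟨r, rfl⟩ : ∃ r, x = Finsupp.single 0 r := 
    ⟨x 0, Finsupp.ext fun i => by rw [Subsingleton.elim i 0, Finsupp.single_eq_same]⟩
  rw [resolutionAugmentation_single, augmentation_eq_cosetSum] at hx
  obtain ⟨p, q, hpq⟩ := exists_eq_of_cosetSum_add_eq_zero hx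
  refine ⟨Finsupp.equivFunOnFinite.symm (![p, q] : Fin 2 → _), ?_⟩
  change Finsupp.equivFunOnFinite.symm
    (![p, q] ᵥ* (!![X n + 1; Y n + 1] : Matrix (Fin 2) (Fin 1) _)) = _
  refine Finsupp.ext fun i => ?_
  rw [Subsingleton.elim i 0]
  simp [hpq]

/-- The 4-periodic free resolution of the trivial representation of a generalized quaternion
group over `𝔽₂`. -/
noncomputable def periodicResolution (hn : Even n) [NeZero n] :
    ProjectiveResolution (Rep.trivial (ZMod 2) (QuaternionGroup n) (ZMod 2)) :=
  Rep.projectiveResolutionOfExact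
    (fun k => Rep.free (ZMod 2) (QuaternionGroup n) (Fin (resolutionRank k)))
    (fun k => Rep.freeMatrixHom (resolutionMatrix n k)) (resolutionAugmentation n)
    (fun k => by
      rw [Rep.freeMatrixHom_comp, resolutionMatrix_mul, Rep.freeMatrixHom_zero])
    (Rep.freeMatrixHom_comp_eq_zero (augmentation_resolutionMatrix hn 0) _)
    (fun c => ⟨Finsupp.single (0 : Fin 1) (single 1 c),
      (resolutionAugmentation_single _ _).trans (by simp [Rep.augmentation])⟩)
    exists_freeMatrixHom_eq_of_resolutionAugmentation_eq_zero
    (fun k x hx => by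
      obtain ⟨g, hg⟩ := exists_vecMul_resolutionMatrix_eq n k (⇑x)
        (Rep.freeMatrixHom_apply_eq_zero_iff.1 hx)
      refine ⟨Finsupp.equivFunOnFinite.symm g, ?_⟩
      exact (congrArg Finsupp.equivFunOnFinite.symm hg).trans (Equiv.symm_apply_apply _ _))

/-- The mod 2 cohomology of a generalized quaternion group, in coordinates. -/
noncomputable def groupCohomologyLinearEquiv (hn : Even n) [NeZero n] (k : ℕ) :
    groupCohomology (Rep.trivial (ZMod 2) (QuaternionGroup n) (ZMod 2)) k ≃ₗ[ZMod 2]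
      (Fin (resolutionRank k) → ZMod 2) :=
  Rep.groupCohomologyLinearEquivHom _ (periodicResolution hn)
    (fun k f => (congrArg (· ≫ f) (ChainComplex.of_d _ _ k)).trans
      (Rep.freeMatrixHom_comp_eq_zero (augmentation_resolutionMatrix hn k) f)) k ≪≫ₗ
    Rep.freeLiftLEquiv (ZMod 2) (QuaternionGroup n) (Fin (resolutionRank k)) _

end GroupAlgebra

end QuaternionGroup

/-- **Statement 7.** For `m ≥ 2` and the generalized quaternion group
`H_m = QuaternionGroup (2^(m-1))` of order `2^(m+1)`, the group cohomology with coefficients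
in the trivial representation on `𝔽₂ = ZMod 2` is a finite-dimensional `𝔽₂`-vector space in
every degree `k`, of dimension `2` if `k ≡ 1, 2 (mod 4)` and of dimension `1` if
`k ≡ 0, 3 (mod 4)`. -/
theorem finrank_groupCohomology_quaternionGroup_trivial_zmod_two (m : ℕ) (hm : 2 ≤ m) :
    ∀ k : ℕ,
      Module.Finite (ZMod 2)
        (groupCohomology (Rep.trivial (ZMod 2) (QuaternionGroup (2 ^ (m - 1))) (ZMod 2)) k) ∧
      (k % 4 = 1 ∨ k % 4 = 2 →
        Module.finrank (ZMod 2)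
          (groupCohomology (Rep.trivial (ZMod 2) (QuaternionGroup (2 ^ (m - 1))) (ZMod 2)) k)
          = 2) ∧
      (k % 4 = 0 ∨ k % 4 = 3 →
        Module.finrank (ZMod 2)
          (groupCohomology (Rep.trivial (ZMod 2) (QuaternionGroup (2 ^ (m - 1))) (ZMod 2)) k)
          = 1) := by
  intro k
  obtain ⟨m, rfl⟩ := Nat.exists_eq_add_of_le' hm
  have hn : Even (2 ^ (m + 2 - 1)) := even_two.pow_of_ne_zero (by omega)
  let e := QuaternionGroup.GroupAlgebra.groupCohomologyLinearEquiv hn k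
  have hr := e.finrank_eq
  rw [Module.finrank_fin_fun] at hr
  exact ⟨.equiv e.symm,
    fun hk => hr.trans (QuaternionGroup.GroupAlgebra.resolutionRank_eq_two hk),
    fun hk => hr.trans (QuaternionGroup.GroupAlgebra.resolutionRank_eq_one hk)⟩
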